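/- Let 0 < p ≤ 2, M := sup_k m_k, let (Φ_n)_{n≥1} be nondecreasing with Φ_n → ∞, and let (α_k)_{k≥1} be an increasing sequence of integers with α_k ≥ 2 and Σ_{k=1}^∞ Φ_{M_{α_k}}^{−p/4} < ∞. Define λ_k := Φ_{M_{α_k}}^{−1/4}, a_k := (M_{α_k}^{1/p−1}/M)(D_{M_{α_k+1}} − D_{M_{α_k}}), and f^{(A)} := Σ_{{k : α_k < A}} λ_k a_k for A ∈ ℕ. Then f = (f^{(A)})_{A∈ℕ} is a martingale belonging to the Hardy space H_p(G_m). -/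

import Mathlib

open MeasureTheory Filter Finset
open scoped Classical ENNReal NNReal

noncomputable section

namespace VilenkinPaper

/-- The generalized powers `M_0 = 1`, `M_{k+1} = m_k M_k`. -/
def Mseq (m : ℕ → ℕ) : ℕ → ℕ
  | 0 => 1
  | k + 1 => m k * Mseq m k

/-- The Vilenkin group `G_m = ∏_k ℤ_{m_k}`. -/
abbrev Gm (m : ℕ → ℕ) : Type := (k : ℕ) → ZMod (m k)

/-- The `j`-th digit of `n` in the generalized number system based on `m`. -/
def digit (m : ℕ → ℕ) (n j : ℕ) : ℕ := n / Mseq m j % m j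

/-- The generalized Rademacher functions `r_k(x) = exp(2πi x_k / m_k)`. -/
def rad (m : ℕ → ℕ) (k : ℕ) (x : Gm m) : ℂ :=
  Complex.exp (2 * Real.pi * Complex.I * ((x k).val : ℂ) / (m k : ℂ))

/-- The Vilenkin system `ψ_n = ∏_k r_k^{n_k}`. -/
def psi (m : ℕ → ℕ) (n : ℕ) (x : Gm m) : ℂ := ∏ᶠ k : ℕ, rad m k x ^ digit m n k

/-- The Dirichlet kernels `D_n = ∑_{k<n} ψ_k`. -/
def Dker (m : ℕ → ℕ) (n : ℕ) (x : Gm m) : ℂ := ∑ k ∈ Finset.range n, psi m k x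

/-- The interval `I_n(x)` : all `y` agreeing with `x` on the first `n` coordinates. -/
def Iset (m : ℕ → ℕ) (n : ℕ) (x : Gm m) : Set (Gm m) := {y | ∀ k < n, y k = x k}

/-- `I_n := I_n(0)`. -/
def IsetO (m : ℕ → ℕ) (n : ℕ) : Set (Gm m) := Iset m n 0

/-- `μ` is the normalized Haar (product) measure iff every interval `I_n(x)` has
measure `1 / M_n`. -/
def IsHaarGm (m : ℕ → ℕ) (μ : Measure (Gm m)) : Prop :=
  ∀ n x, μ (Iset m n x) = ((Mseq m n : ℝ≥0∞))⁻¹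

/-- The σ-algebra `F_n` generated by the intervals `{I_n(x)}`, i.e. by the first `n`
coordinates. -/
def filt (m : ℕ → ℕ) (n : ℕ) : MeasurableSpace (Gm m) :=
  MeasurableSpace.comap (fun x (k : Fin n) => x k) ⊤

/-- A (Vilenkin) martingale with respect to the filtration `F_n`. -/
def IsVMartingale (m : ℕ → ℕ) (μ : Measure (Gm m)) (f : ℕ → Gm m → ℂ) : Prop :=
  (∀ n, Integrable (f n) μ) ∧
  (∀ n, Measurable[filt m n] (f n)) ∧
  (∀ n N, n ≤ N → μ[f N | filt m n] =ᵐ[μ] f n)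

/-- Membership in the martingale Hardy space `H_p`: the maximal function
`f* = sup_n |f^{(n)}|` belongs to `L_p`. -/
def MemHp (m : ℕ → ℕ) (μ : Measure (Gm m)) (p : ℝ) (f : ℕ → Gm m → ℂ) : Prop :=
  ∫⁻ x, (⨆ n, (‖f n x‖₊ : ℝ≥0∞)) ^ p ∂μ < ⊤

/-- The `i`-th Vilenkin–Fourier coefficient of an integrable function. -/
def fourierCoefFn (m : ℕ → ℕ) (μ : Measure (Gm m)) (g : Gm m → ℂ) (i : ℕ) : ℂ :=
  ∫ x, g x * (starRingEnd ℂ) (psi m i x) ∂μ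

/-- The partial sum `S_n` built from a sequence `c` of Fourier coefficients. -/
def Spart (m : ℕ → ℕ) (c : ℕ → ℂ) (n : ℕ) (x : Gm m) : ℂ :=
  ∑ k ∈ Finset.range n, c k * psi m k x

/-- The weak `L_{p,∞}` quasinorm `sup_{λ>0} λ μ(|g| > λ)^{1/p}`. -/
def wLp (m : ℕ → ℕ) (μ : Measure (Gm m)) (p : ℝ) (g : Gm m → ℂ) : ℝ≥0∞ :=
  ⨆ (t : ℝ) (_ : 0 < t), ENNReal.ofReal t * μ {x | t < ‖g x‖} ^ (1 / p)

/-- `|n| = max {j : n_j ≠ 0}`. -/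
def maxDigit (m : ℕ → ℕ) (n : ℕ) : ℕ := sSup {j | digit m n j ≠ 0}

/-- The set `ℕ_{n_0}` of positive integers with `n_0 = n_{|n|} = 1`. -/
def Nn0 (m : ℕ → ℕ) : Set ℕ :=
  {n | 0 < n ∧ digit m n 0 = 1 ∧ digit m n (maxDigit m n) = 1}

/-- The atom `a = (M_α^{1/p-1}/M) (D_{M_{α+1}} - D_{M_α})`. -/
def atomFun (m : ℕ → ℕ) (MM : ℕ) (p : ℝ) (a : ℕ) (x : Gm m) : ℂ :=
  (((Mseq m a : ℝ) ^ (1 / p - 1) / (MM : ℝ) : ℝ) : ℂ) *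
    (Dker m (Mseq m (a + 1)) x - Dker m (Mseq m a) x)

/-- The coefficients `λ_k = Φ_{M_{α_k}}^{-1/4}`. -/
def lamSeq (m : ℕ → ℕ) (Φ : ℕ → ℝ) (α : ℕ → ℕ) (k : ℕ) : ℝ :=
  Φ (Mseq m (α k)) ^ (-(1 / 4 : ℝ))

/-- The martingale `f^{(A)} = ∑_{k : α_k < A} λ_k a_k` of the counterexample construction. -/
def fCon (m : ℕ → ℕ) (MM : ℕ) (p : ℝ) (Φ : ℕ → ℝ) (α : ℕ → ℕ) (A : ℕ) (x : Gm m) : ℂ :=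
  ∑ᶠ (k : ℕ) (_ : α k < A), (lamSeq m Φ α k : ℂ) * atomFun m MM p (α k) x

lemma Mseq_pos {m : ℕ → ℕ} (hm : ∀ k, 2 ≤ m k) (n : ℕ) : 0 < Mseq m n := by
  induction n with
  | zero => simp [Mseq]
  | succ n ih => exact Nat.mul_pos (by have := hm n; omega) ih

lemma two_mul_Mseq_le {m : ℕ → ℕ} (hm : ∀ k, 2 ≤ m k) (n : ℕ) :
    2 * Mseq m n ≤ Mseq m (n + 1) :=
  Nat.mul_le_mul_right _ (hm n)

lemma Mseq_dvd (m : ℕ → ℕ) {i n : ℕ} (h : i ≤ n) : Mseq m i ∣ Mseq m n := by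
  induction n, h using Nat.le_induction with
  | base => exact dvd_rfl
  | succ n _ ih => exact ih.mul_left _

lemma Mseq_mono {m : ℕ → ℕ} (hm : ∀ k, 2 ≤ m k) : Monotone (Mseq m) :=
  monotone_nat_of_le_succ fun n => by have := two_mul_Mseq_le hm n; omega

lemma digit_eq_zero_of_lt {m : ℕ → ℕ} {n i : ℕ} (h : n < Mseq m i) : digit m n i = 0 := by
  simp [digit, Nat.div_eq_of_lt h]

lemma digit_add_mul_of_lt {m : ℕ → ℕ} (hm : ∀ k, 2 ≤ m k) {i n : ℕ} (h : i < n) (j a : ℕ) :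
    digit m (j + Mseq m n * a) i = digit m j i := by
  obtain ⟨c, hc⟩ := Mseq_dvd m (Nat.succ_le_of_lt h)
  have : Mseq m n * a = Mseq m i * (m i * (c * a)) := by
    rw [hc, Nat.succ_eq_add_one, Mseq]; ring
  rw [digit, digit, this, Nat.add_mul_div_left _ _ (Mseq_pos hm i), Nat.add_mul_mod_self_left]

lemma digit_add_mul_self {m : ℕ → ℕ} (hm : ∀ k, 2 ≤ m k) {n j a : ℕ} (hj : j < Mseq m n)
    (ha : a < m n) : digit m (j + Mseq m n * a) n = a := by
  rw [digit, Nat.add_mul_div_left _ _ (Mseq_pos hm n), Nat.div_eq_of_lt hj, zero_add,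
    Nat.mod_eq_of_lt ha]

lemma psi_eq_prod {m : ℕ → ℕ} (hm : ∀ k, 2 ≤ m k) {n N : ℕ} (h : n < Mseq m N) (x : Gm m) :
    psi m n x = ∏ i ∈ Finset.range N, rad m i x ^ digit m n i := by
  refine finprod_eq_prod_of_mulSupport_subset _ fun i hi => ?_
  by_contra hiN
  have hNi : N ≤ i := by simpa using hiN
  exact hi (by simp [digit_eq_zero_of_lt (h.trans_le (Mseq_mono hm hNi))])

lemma psi_add_mul {m : ℕ → ℕ} (hm : ∀ k, 2 ≤ m k) {n j a : ℕ} (hj : j < Mseq m n)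
    (ha : a < m n) (x : Gm m) :
    psi m (j + Mseq m n * a) x = psi m j x * rad m n x ^ a := by
  have hlt : j + Mseq m n * a < Mseq m (n + 1) := by
    calc j + Mseq m n * a < Mseq m n + Mseq m n * a := by omega
      _ = (a + 1) * Mseq m n := by ring
      _ ≤ Mseq m (n + 1) := Nat.mul_le_mul_right _ ha
  rw [psi_eq_prod hm hlt, psi_eq_prod hm hj, Finset.prod_range_succ, digit_add_mul_self hm hj ha]
  congr 1
  exact Finset.prod_congr rfl fun i hi => by
    rw [digit_add_mul_of_lt hm (Finset.mem_range.1 hi)]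

lemma Dker_Mseq_mul {m : ℕ → ℕ} (hm : ∀ k, 2 ≤ m k) (n : ℕ) (x : Gm m) {c : ℕ} (hc : c ≤ m n) :
    Dker m (Mseq m n * c) x =
      Dker m (Mseq m n) x * ∑ a ∈ Finset.range c, rad m n x ^ a := by
  induction c with
  | zero => simp [Dker]
  | succ c ih =>
    have ih := ih (by omega)
    simp only [Dker] at ih ⊢
    rw [Nat.mul_succ, Finset.sum_range_add, ih, Finset.sum_range_succ, mul_add]
    congr 1
    rw [Finset.sum_mul]
    refine Finset.sum_congr rfl fun j hj => ?_
    rw [add_comm _ j, psi_add_mul hm (Finset.mem_range.1 hj) (by omega)]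

lemma sum_rad_pow {m : ℕ → ℕ} (hm : ∀ k, 2 ≤ m k) (n : ℕ) (x : Gm m) :
    ∑ a ∈ Finset.range (m n), rad m n x ^ a = if x n = 0 then (m n : ℂ) else 0 := by
  have hn : m n ≠ 0 := by have := hm n; omega
  have : NeZero (m n) := ⟨hn⟩
  have hrad : rad m n x = Complex.exp (2 * Real.pi * Complex.I / (m n : ℂ)) ^ (x n).val := by
    rw [rad, ← Complex.exp_nat_mul]; congr 1; ring
  have hprim := Complex.isPrimitiveRoot_exp (m n) hn
  split_ifs with h
  · simp [hrad, h]
  · have hne : rad m n x ≠ 1 := by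
      rw [hrad, Ne, hprim.pow_eq_one_iff_dvd]
      intro hd
      have h0 := Nat.eq_zero_of_dvd_of_lt hd (ZMod.val_lt (x n))
      exact h ((ZMod.val_eq_zero _).1 h0)
    have hone : rad m n x ^ m n = 1 := by
      rw [hrad, ← pow_mul, mul_comm (x n).val, pow_mul, hprim.pow_eq_one, one_pow]
    rw [geom_sum_eq hne, hone, sub_self, zero_div]

/-- Paley's lemma: `D_{M_n} = M_n 1_{I_n}`. -/
lemma Dker_Mseq {m : ℕ → ℕ} (hm : ∀ k, 2 ≤ m k) (n : ℕ) :
    Dker m (Mseq m n) = (IsetO m n).indicator fun _ => (Mseq m n : ℂ) := by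
  funext x
  induction n with
  | zero => simp [Dker, Mseq, IsetO, Iset, psi_eq_prod hm (N := 0) (n := 0) (by simp [Mseq])]
  | succ n ih =>
    have hmem : x ∈ IsetO m (n + 1) ↔ x ∈ IsetO m n ∧ x n = 0 := by
      simpa [IsetO, Iset] using Nat.forall_lt_succ_right (p := fun k => x k = 0)
    rw [Mseq, mul_comm, Dker_Mseq_mul hm n x le_rfl, ih, sum_rad_pow hm]
    by_cases h1 : x ∈ IsetO m n <;> by_cases h2 : x n = 0 <;>
      simp [Set.indicator, hmem, h1, h2]

lemma IsetO_anti (m : ℕ → ℕ) {n N : ℕ} (h : n ≤ N) : IsetO m N ⊆ IsetO m n :=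
  fun _ hx k hk => hx k (hk.trans_le h)

lemma filt_le {m : ℕ → ℕ} (hm : ∀ k, 2 ≤ m k) (n : ℕ) : filt m n ≤ MeasurableSpace.pi := by
  have : ∀ k, NeZero (m k) := fun k => ⟨by have := hm k; omega⟩
  rintro _ ⟨t, -, rfl⟩
  have ht : MeasurableSet t := t.toFinite.measurableSet
  exact (measurable_pi_lambda (fun (x : Gm m) (k : Fin n) => x k)
    fun k => measurable_pi_apply (k : ℕ)) ht

lemma filt_mono (m : ℕ → ℕ) {n N : ℕ} (h : n ≤ N) : filt m n ≤ filt m N := by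
  rintro _ ⟨t, -, rfl⟩
  exact ⟨(fun (y : (k : Fin N) → ZMod (m k)) (k : Fin n) => y (Fin.castLE h k)) ⁻¹' t,
    trivial, rfl⟩

lemma measurableSet_filt_IsetO (m : ℕ → ℕ) (n : ℕ) : MeasurableSet[filt m n] (IsetO m n) := by
  refine ⟨{0}, trivial, ?_⟩
  ext x
  simp only [Set.mem_preimage, Set.mem_singleton_iff, IsetO, Iset, Set.mem_ofPred_eq]
  exact ⟨fun h k hk => congrFun h ⟨k, hk⟩, fun h => funext fun k => h k k.2⟩

lemma measurable_Dker_Mseq {m : ℕ → ℕ} (hm : ∀ k, 2 ≤ m k) (n : ℕ) :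
    Measurable[filt m n] (Dker m (Mseq m n)) := by
  rw [Dker_Mseq hm]
  exact measurable_const.indicator (measurableSet_filt_IsetO m n)

lemma IsHaarGm.isProbabilityMeasure {m : ℕ → ℕ} {μ : Measure (Gm m)} (hμ : IsHaarGm m μ) :
    IsProbabilityMeasure μ :=
  ⟨by simpa [Iset, Mseq] using hμ 0 0⟩

lemma integrable_Dker_Mseq {m : ℕ → ℕ} (hm : ∀ k, 2 ≤ m k) {μ : Measure (Gm m)}
    (hμ : IsHaarGm m μ) (n : ℕ) : Integrable (Dker m (Mseq m n)) μ := by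
  have := hμ.isProbabilityMeasure
  rw [Dker_Mseq hm]
  exact (integrable_const _).indicator (filt_le hm n _ (measurableSet_filt_IsetO m n))

lemma setIntegral_Dker_Mseq {m : ℕ → ℕ} (hm : ∀ k, 2 ≤ m k) {μ : Measure (Gm m)}
    (hμ : IsHaarGm m μ) {n N : ℕ} (h : n ≤ N) {s : Set (Gm m)} (hs : MeasurableSet[filt m n] s) :
    ∫ x in s, Dker m (Mseq m N) x ∂μ = if (0 : Gm m) ∈ s then 1 else 0 := by
  have := hμ.isProbabilityMeasure
  have hN : ((Mseq m N : ℕ) : ℂ) ≠ 0 := by exact_mod_cast (Mseq_pos hm N).ne'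
  have hI := filt_le hm N _ (measurableSet_filt_IsetO m N)
  have hsat : ∀ x ∈ IsetO m N, (x ∈ s ↔ (0 : Gm m) ∈ s) := by
    obtain ⟨t, -, rfl⟩ := hs
    intro x hx
    have : (fun k : Fin n => x k) = fun k : Fin n => (0 : Gm m) k :=
      funext fun k => hx k (k.2.trans_le h)
    simp only [Set.mem_preimage, this]
  rw [Dker_Mseq hm, integral_indicator hI, Measure.restrict_restrict hI]
  split_ifs with h0
  · have : IsetO m N ∩ s = IsetO m N :=
      Set.inter_eq_left.2 fun x hx => (hsat x hx).2 h0
    rw [this, setIntegral_const, measureReal_def, IsetO, hμ N 0]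
    simp [hN]
  · have : IsetO m N ∩ s = ∅ := by
      ext x
      simp only [Set.mem_inter_iff, Set.mem_empty_iff_false, iff_false, not_and]
      exact fun hx hxs => h0 ((hsat x hx).1 hxs)
    simp [this]

lemma measurable_atomFun {m : ℕ → ℕ} (hm : ∀ k, 2 ≤ m k) (MM : ℕ) (p : ℝ) {a n : ℕ} (h : a < n) :
    Measurable[filt m n] (atomFun m MM p a) := by
  have h1 := (measurable_Dker_Mseq hm (a + 1)).mono (filt_mono m h) le_rfl
  have h2 := (measurable_Dker_Mseq hm a).mono (filt_mono m h.le) le_rfl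
  exact (h1.sub h2).const_mul _

lemma integrable_atomFun {m : ℕ → ℕ} (hm : ∀ k, 2 ≤ m k) (MM : ℕ) (p : ℝ) {μ : Measure (Gm m)}
    (hμ : IsHaarGm m μ) (a : ℕ) : Integrable (atomFun m MM p a) μ :=
  ((integrable_Dker_Mseq hm hμ (a + 1)).sub (integrable_Dker_Mseq hm hμ a)).const_mul _

lemma setIntegral_atomFun {m : ℕ → ℕ} (hm : ∀ k, 2 ≤ m k) (MM : ℕ) (p : ℝ) {μ : Measure (Gm m)}
    (hμ : IsHaarGm m μ) {n a : ℕ} (h : n ≤ a) {s : Set (Gm m)} (hs : MeasurableSet[filt m n] s) :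
    ∫ x in s, atomFun m MM p a x ∂μ = 0 := by
  simp only [atomFun]
  rw [integral_const_mul, integral_sub (integrable_Dker_Mseq hm hμ _).integrableOn
    (integrable_Dker_Mseq hm hμ _).integrableOn, setIntegral_Dker_Mseq hm hμ h hs,
    setIntegral_Dker_Mseq hm hμ (h.trans a.le_succ) hs, sub_self, mul_zero]

lemma norm_atomFun_le {m : ℕ → ℕ} (hm : ∀ k, 2 ≤ m k) {MM : ℕ} (hMM : ∀ k, m k ≤ MM) (p : ℝ)
    (a : ℕ) (x : Gm m) :
    ‖atomFun m MM p a x‖ ≤ if x ∈ IsetO m a then (Mseq m a : ℝ) ^ (1 / p) else 0 := by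
  have hMpos : (0 : ℝ) < Mseq m a := by exact_mod_cast Mseq_pos hm a
  have hMM0 : (0 : ℝ) < MM := by
    have h1 := hm 0
    have h2 := hMM 0
    exact_mod_cast (by omega : 0 < MM)
  rw [atomFun, Dker_Mseq hm, Dker_Mseq hm, norm_mul, Complex.norm_real, Real.norm_of_nonneg
    (by positivity)]
  split_ifs with h
  · have hb : ‖(IsetO m (a + 1)).indicator (fun _ => (Mseq m (a + 1) : ℂ)) x -
        (IsetO m a).indicator (fun _ => (Mseq m a : ℂ)) x‖ ≤ MM * Mseq m a := by
      have hle : (Mseq m (a + 1) : ℝ) ≤ MM * Mseq m a := by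
        exact_mod_cast Nat.mul_le_mul_right _ (hMM a)
      have h2 : (2 : ℝ) * Mseq m a ≤ Mseq m (a + 1) := by exact_mod_cast two_mul_Mseq_le hm a
      rw [Set.indicator_of_mem h]
      by_cases h' : x ∈ IsetO m (a + 1)
      · rw [Set.indicator_of_mem h']
        have : ((Mseq m (a + 1) : ℂ) - (Mseq m a : ℂ)) =
            ((Mseq m (a + 1) - Mseq m a : ℝ) : ℂ) := by push_cast; ring
        rw [this, Complex.norm_real, Real.norm_of_nonneg (by linarith)]
        linarith
      · rw [Set.indicator_of_notMem h', zero_sub, norm_neg, Complex.norm_natCast]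
        linarith
    calc _ ≤ (Mseq m a : ℝ) ^ (1 / p - 1) / MM * (MM * Mseq m a) := by gcongr
      _ = (Mseq m a : ℝ) ^ (1 / p) := by
        rw [Real.rpow_sub_one hMpos.ne']
        field_simp
  · have h' : x ∉ IsetO m (a + 1) := fun hx => h (IsetO_anti m a.le_succ hx)
    simp [h, h']

lemma fCon_eq_sum {m : ℕ → ℕ} (MM : ℕ) (p : ℝ) (Φ : ℕ → ℝ) {α : ℕ → ℕ} (hα : StrictMono α)
    {A K : ℕ} (h : A ≤ K) :
    fCon m MM p Φ α A = fun x => ∑ k ∈ Finset.range K,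
      if α k < A then (lamSeq m Φ α k : ℂ) * atomFun m MM p (α k) x else 0 := by
  funext x
  rw [fCon]
  simp only [finsum_eq_if]
  refine finsum_eq_sum_of_support_subset _ fun k hk => ?_
  have hkA : α k < A := by
    by_contra hc
    exact hk (if_neg hc)
  have := hα.id_le k
  simp only [id] at this
  simp only [Finset.coe_range, Set.mem_Iio]
  omega

lemma isVMartingale_fCon {m : ℕ → ℕ} (hm : ∀ k, 2 ≤ m k) (MM : ℕ) {μ : Measure (Gm m)}
    (hμ : IsHaarGm m μ) (p : ℝ) (Φ : ℕ → ℝ) {α : ℕ → ℕ} (hα : StrictMono α) :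
    IsVMartingale m μ (fCon m MM p Φ α) := by
  have := hμ.isProbabilityMeasure
  have hti : ∀ A k, Integrable (fun x => if α k < A then
      (lamSeq m Φ α k : ℂ) * atomFun m MM p (α k) x else 0) μ := by
    intro A k
    split_ifs
    · exact (integrable_atomFun hm MM p hμ _).const_mul _
    · exact integrable_zero _ _ _
  have hint : ∀ n, Integrable (fCon m MM p Φ α n) μ := by
    intro n
    rw [fCon_eq_sum MM p Φ hα le_rfl]
    exact integrable_finsetSum _ fun k _ => hti n k
  have hmeas : ∀ n, Measurable[filt m n] (fCon m MM p Φ α n) := by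
    intro n
    rw [fCon_eq_sum MM p Φ hα le_rfl]
    refine Finset.measurable_fun_sum _ fun k _ => ?_
    split_ifs with h
    · exact (measurable_atomFun hm MM p h).const_mul _
    · exact measurable_const
  refine ⟨hint, hmeas, fun n N hnN => ?_⟩
  refine (ae_eq_condExp_of_forall_setIntegral_eq (filt_le hm n) (hint N)
    (fun s _ _ => (hint n).integrableOn) (fun s hs _ => ?_)
    (hmeas n).stronglyMeasurable.aestronglyMeasurable).symm
  rw [fCon_eq_sum MM p Φ hα hnN, fCon_eq_sum MM p Φ hα (le_refl N),
    integral_finsetSum _ fun k _ => (hti n k).integrableOn,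
    integral_finsetSum _ fun k _ => (hti N k).integrableOn]
  refine Finset.sum_congr rfl fun k _ => ?_
  by_cases h1 : α k < n
  · simp only [h1, h1.trans_le hnN]
  · by_cases h2 : α k < N
    · simp only [h1, h2, if_true, if_false, integral_zero]
      rw [integral_const_mul, setIntegral_atomFun hm MM p hμ (not_lt.1 h1) hs, mul_zero]
    · simp only [h1, h2]

lemma exists_rpow_contraction {p : ℝ} (hp : 0 < p) :
    ∃ θ < (1 : ℝ), ∃ C : ℝ, ∀ b l : ℝ, 0 ≤ b → 0 ≤ l →
      ((2 : ℝ) ^ (-(1 / p)) * b + l) ^ p ≤ θ * b ^ p + C * l ^ p := by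
  set q : ℝ := (2 : ℝ) ^ (-(1 / p)) with hq
  have hq0 : 0 < q := by positivity
  have hq1 : q < 1 := Real.rpow_lt_one_of_one_lt_of_neg one_lt_two (by simpa using hp)
  rcases le_total p 1 with h | h
  · refine ⟨q ^ p, Real.rpow_lt_one hq0.le hq1 hp, 1, fun b l hb hl => ?_⟩
    rw [← Real.mul_rpow hq0.le hb, one_mul]
    exact Real.rpow_add_le_add_rpow (mul_nonneg hq0.le hb) hl hp.le h
  · have hq' : 0 < 1 - q := by linarith
    refine ⟨q, hq1, (1 - q) * (1 / (1 - q)) ^ p, fun b l hb hl => ?_⟩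
    have := (convexOn_rpow h).2 (Set.mem_Ici.2 hb)
      (Set.mem_Ici.2 (show 0 ≤ 1 / (1 - q) * l by positivity)) hq0.le hq'.le (by ring)
    simp only [smul_eq_mul] at this
    rw [Real.mul_rpow (by positivity) hl] at this
    calc _ = (q * b + (1 - q) * (1 / (1 - q) * l)) ^ p := by congr 1; field_simp
      _ ≤ _ := this
      _ = _ := by ring

lemma summable_of_le_mul_add {s l : ℕ → ℝ} {θ : ℝ} (hθ : θ < 1)
    (hs : ∀ n, 0 ≤ s n) (hl0 : ∀ n, 0 ≤ l n) (hl : Summable l) (h0 : s 0 ≤ l 0)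
    (h : ∀ n, s (n + 1) ≤ θ * s n + l (n + 1)) : Summable s := by
  have key : ∀ N, ∑ n ∈ Finset.range (N + 1), s n ≤
      θ * ∑ n ∈ Finset.range N, s n + ∑ n ∈ Finset.range (N + 1), l n := by
    intro N
    induction N with
    | zero => simpa using h0
    | succ N ih =>
      rw [Finset.sum_range_succ, Finset.sum_range_succ l, Finset.sum_range_succ s N, mul_add]
      rw [Finset.sum_range_succ] at ih
      have := h N
      linarith
  refine summable_of_sum_range_le (c := (∑' n, l n) / (1 - θ)) hs fun N => ?_
  rw [le_div_iff₀ (by linarith)]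
  have h1 : ∑ n ∈ Finset.range N, s n ≤ ∑ n ∈ Finset.range (N + 1), s n := by
    rw [Finset.sum_range_succ]; linarith [hs N]
  have h2 := hl.sum_le_tsum (Finset.range (N + 1)) fun n _ => hl0 n
  linarith [key N]

/-- A discrete Hardy inequality for lacunary weights. -/
lemma summable_lacunary_hardy {p : ℝ} (hp : 0 < p) {W l : ℕ → ℝ} (hW : ∀ n, 0 < W n)
    (hW2 : ∀ n, 2 * W n ≤ W (n + 1)) (hl : ∀ n, 0 ≤ l n) (hsum : Summable fun n => l n ^ p) :
    Summable fun N => (∑ k ∈ Finset.range (N + 1), l k * W k ^ (1 / p)) ^ p * (W N)⁻¹ := by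
  obtain ⟨θ, hθ, C, hC⟩ := exists_rpow_contraction hp
  have hS : ∀ N, 0 ≤ ∑ k ∈ Finset.range N, l k * W k ^ (1 / p) := fun N =>
    Finset.sum_nonneg fun k _ => mul_nonneg (hl k) (Real.rpow_nonneg (hW k).le _)
  have hcancel : ∀ N, W N ^ (1 / p) * W N ^ (-(1 / p)) = 1 := fun N => by
    rw [← Real.rpow_add (hW N), add_neg_cancel, Real.rpow_zero]
  set b : ℕ → ℝ := fun N =>
    (∑ k ∈ Finset.range (N + 1), l k * W k ^ (1 / p)) * W N ^ (-(1 / p)) with hb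
  have hb0 : ∀ N, 0 ≤ b N := fun N => mul_nonneg (hS _) (Real.rpow_nonneg (hW N).le _)
  have hbp : ∀ N, (∑ k ∈ Finset.range (N + 1), l k * W k ^ (1 / p)) ^ p * (W N)⁻¹ = b N ^ p := by
    intro N
    rw [hb, Real.mul_rpow (hS _) (Real.rpow_nonneg (hW N).le _), ← Real.rpow_mul (hW N).le,
      neg_mul, one_div, inv_mul_cancel₀ hp.ne', Real.rpow_neg_one]
  simp only [hbp]
  have hCl : ∀ n, l n ^ p ≤ C * l n ^ p := fun n => by
    simpa [Real.zero_rpow hp.ne'] using hC 0 (l n) le_rfl (hl n)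
  refine summable_of_le_mul_add hθ (fun n => Real.rpow_nonneg (hb0 n) _)
    (fun n => (Real.rpow_nonneg (hl n) _).trans (hCl n)) (hsum.mul_left C) ?_ fun n => ?_
  · have : b 0 = l 0 := by simp only [hb]; simp [mul_assoc]; rw [← one_div, hcancel, mul_one]
    rw [this]
    exact hCl 0
  · refine le_trans (Real.rpow_le_rpow (hb0 _) ?_ hp.le) (hC (b n) (l (n + 1)) (hb0 n) (hl _))
    have hWle : W (n + 1) ^ (-(1 / p)) ≤ (2 : ℝ) ^ (-(1 / p)) * W n ^ (-(1 / p)) := by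
      rw [← Real.mul_rpow zero_le_two (hW n).le]
      exact Real.rpow_le_rpow_of_nonpos (by linarith [hW n]) (hW2 n)
        (by simpa using hp.le)
    calc b (n + 1) = (∑ k ∈ Finset.range (n + 1), l k * W k ^ (1 / p)) * W (n + 1) ^ (-(1 / p))
          + l (n + 1) * (W (n + 1) ^ (1 / p) * W (n + 1) ^ (-(1 / p))) := by
          simp only [hb]; rw [Finset.sum_range_succ]; ring
      _ ≤ (∑ k ∈ Finset.range (n + 1), l k * W k ^ (1 / p)) *
          ((2 : ℝ) ^ (-(1 / p)) * W n ^ (-(1 / p))) + l (n + 1) := by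
          rw [hcancel, mul_one]
          gcongr
          exact hS _
      _ = _ := by simp only [hb]; ring

lemma norm_sum_rpow_le {p : ℝ} (hp : 0 < p) {g : ℕ → ℂ} {c : ℕ → ℝ} {P : ℕ → Prop}
    (hc : ∀ k, 0 ≤ c k) (hg : ∀ k, ‖g k‖ ≤ if P k then c k else 0) (K : ℕ) :
    ‖∑ k ∈ Finset.range K, g k‖ ^ p ≤
      ∑ k ∈ Finset.range K, if P k then (∑ j ∈ Finset.range (k + 1), c j) ^ p else 0 := by
  have hT : ∀ k, 0 ≤ if P k then (∑ j ∈ Finset.range (k + 1), c j) ^ p else 0 := fun k => by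
    split_ifs
    · exact Real.rpow_nonneg (Finset.sum_nonneg fun j _ => hc j) _
    · exact le_rfl
  induction K with
  | zero => simp [Real.zero_rpow hp.ne']
  | succ K ih =>
    rw [Finset.sum_range_succ (fun k => if P k then _ else _)]
    by_cases h : P K
    · rw [if_pos h]
      refine le_add_of_nonneg_of_le (Finset.sum_nonneg fun k _ => hT k) ?_
      refine Real.rpow_le_rpow (norm_nonneg _) ((norm_sum_le _ _).trans ?_) hp.le
      refine Finset.sum_le_sum fun k _ => (hg k).trans ?_
      split_ifs
      · exact le_rfl
      · exact hc k
    · have h0 : g K = 0 := norm_le_zero_iff.1 (by simpa [h] using hg K)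
      simpa [Finset.sum_range_succ _ K, h0, h] using ih

lemma memHp_fCon {m : ℕ → ℕ} (hm : ∀ k, 2 ≤ m k) {MM : ℕ} (hMM : ∀ k, m k ≤ MM)
    {μ : Measure (Gm m)} (hμ : IsHaarGm m μ) {p : ℝ} (hp : 0 < p) {Φ : ℕ → ℝ}
    (hΦpos : ∀ n, 0 < Φ n) {α : ℕ → ℕ} (hα : StrictMono α)
    (hsum : Summable fun k => Φ (Mseq m (α k)) ^ (-(p / 4) : ℝ)) :
    MemHp m μ p (fCon m MM p Φ α) := by
  have hl : ∀ k, 0 ≤ lamSeq m Φ α k := fun k => Real.rpow_nonneg (hΦpos _).le _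
  have hW : ∀ k, (0 : ℝ) < Mseq m (α k) := fun k => by exact_mod_cast Mseq_pos hm _
  have hlp : Summable fun k => lamSeq m Φ α k ^ p := by
    refine hsum.congr fun k => ?_
    rw [lamSeq, ← Real.rpow_mul (hΦpos _).le]
    congr 1
    ring
  have hW2 : ∀ k, 2 * (Mseq m (α k) : ℝ) ≤ Mseq m (α (k + 1)) := fun k => by
    exact_mod_cast (two_mul_Mseq_le hm _).trans (Mseq_mono hm (hα k.lt_succ_self))
  have hsummable := summable_lacunary_hardy hp hW hW2 hl hlp
  set c : ℕ → ℝ := fun k => lamSeq m Φ α k * (Mseq m (α k) : ℝ) ^ (1 / p) with hc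
  have hc0 : ∀ k, 0 ≤ c k := fun k => mul_nonneg (hl k) (Real.rpow_nonneg (hW k).le _)
  set T : ℕ → ℝ := fun k => (∑ j ∈ Finset.range (k + 1), c j) ^ p with hT
  have hT0 : ∀ k, 0 ≤ T k := fun k => Real.rpow_nonneg (Finset.sum_nonneg fun j _ => hc0 j) _
  have hpt : ∀ x, (⨆ n, (‖fCon m MM p Φ α n x‖₊ : ℝ≥0∞)) ^ p ≤
      ∑' k, (IsetO m (α k)).indicator (fun _ => ENNReal.ofReal (T k)) x := by
    intro x
    rw [← ENNReal.le_rpow_inv_iff hp]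
    refine iSup_le fun A => ?_
    rw [ENNReal.le_rpow_inv_iff hp]
    refine le_trans ?_ (ENNReal.sum_le_tsum (Finset.range A))
    have hbound := norm_sum_rpow_le hp (P := fun k => x ∈ IsetO m (α k)) hc0 (g := fun k =>
      if α k < A then (lamSeq m Φ α k : ℂ) * atomFun m MM p (α k) x else 0) (fun k => ?_) A
    · have hsum_ind : ∑ k ∈ Finset.range A,
          (IsetO m (α k)).indicator (fun _ => ENNReal.ofReal (T k)) x =
          ENNReal.ofReal (∑ k ∈ Finset.range A, if x ∈ IsetO m (α k) then T k else 0) := by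
        rw [ENNReal.ofReal_sum_of_nonneg fun k _ => by split_ifs; exacts [hT0 k, le_rfl]]
        refine Finset.sum_congr rfl fun k _ => ?_
        by_cases h : x ∈ IsetO m (α k) <;> simp [h]
      rw [hsum_ind, fCon_eq_sum MM p Φ hα le_rfl, ← enorm_eq_nnnorm, ← ofReal_norm,
        ENNReal.ofReal_rpow_of_nonneg (norm_nonneg _) hp.le]
      exact ENNReal.ofReal_le_ofReal hbound
    · have hatom := norm_atomFun_le hm hMM p (α k) x
      by_cases hA : α k < A
      · simp only [hA, if_true]
        rw [norm_mul, Complex.norm_real, Real.norm_of_nonneg (hl k)]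
        refine (mul_le_mul_of_nonneg_left hatom (hl k)).trans (le_of_eq ?_)
        split_ifs <;> simp [hc]
      · simp only [hA, if_false, norm_zero]
        split_ifs
        exacts [hc0 k, le_rfl]
  refine (lintegral_mono hpt).trans_lt ?_
  have hI : ∀ k, MeasurableSet (IsetO m (α k)) := fun k =>
    filt_le hm _ _ (measurableSet_filt_IsetO m (α k))
  rw [lintegral_tsum fun k => (measurable_const.indicator (hI k)).aemeasurable]
  have hterm : ∀ k, ∫⁻ x, (IsetO m (α k)).indicator (fun _ => ENNReal.ofReal (T k)) x ∂μ =
      ENNReal.ofReal (T k * (Mseq m (α k) : ℝ)⁻¹) := by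
    intro k
    rw [lintegral_indicator_const (hI k), IsetO, hμ, ENNReal.ofReal_mul (hT0 k),
      ENNReal.ofReal_inv_of_pos (hW k), ENNReal.ofReal_natCast]
  simp only [hterm]
  exact hsummable.tsum_ofReal_lt_top

theorem statement10 (m : ℕ → ℕ) (hm : ∀ k, 2 ≤ m k)
    (MM : ℕ) (hMM : IsLUB (Set.range m) MM)
    (μ : Measure (Gm m)) (hμ : IsHaarGm m μ)
    (p : ℝ) (hp0 : 0 < p) (hp2 : p ≤ 2)
    (Φ : ℕ → ℝ) (hΦpos : ∀ n, 0 < Φ n) (hΦmono : Monotone Φ)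
    (hΦtop : Tendsto Φ atTop atTop)
    (α : ℕ → ℕ) (hα : StrictMono α) (hα2 : ∀ k, 2 ≤ α k)
    (hsum : Summable fun k => Φ (Mseq m (α k)) ^ (-(p / 4) : ℝ)) :
    IsVMartingale m μ (fCon m MM p Φ α) ∧ MemHp m μ p (fCon m MM p Φ α) := by
  have hle : ∀ k, m k ≤ MM := fun k => hMM.1 (Set.mem_range_self k)
  exact ⟨isVMartingale_fCon hm MM hμ p Φ hα, memHp_fCon hm hle hμ hp0 hΦpos hα hsum⟩

end VilenkinPaper
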